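/- arXiv:2104.10528 — 4 statements merged into one kernel-verified Lean document; each statement's English description precedes it below -/
import Mathlib

section
/- Let k ≥ 0. There exists a point c ∈ [0,1] such that f_k is concave on the interval [0,c] and convex on the interval [c,1]. -/
open MeasureTheory Set Filter Topology
open scoped ENNReal NNReal

/-- The space `S = {I,II} × [0,∞) × ℕ`; `true` stands for Player I,
`false` for Player II. -/
abbrev GameS : Type := Bool × ℝ≥0 × ℕ

/-- `pk p i k n = p({ι = i} ∩ {γ ≥ k} ∩ {ξ = n})`. -/
noncomputable def pk (p : Measure GameS) (i : Bool) (k : ℝ≥0) (n : ℕ) : ℝ :=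
  (p {s : GameS | s.1 = i ∧ k ≤ s.2.1 ∧ s.2.2 = n}).toReal

/-- The generating function `G_i(k,x) = Σ_n p_i(k,n) xⁿ`. -/
noncomputable def Gk (p : Measure GameS) (i : Bool) (k : ℝ≥0) (x : ℝ) : ℝ :=
  ∑' n : ℕ, pk p i k n * x ^ n

/-- The value generating function
`f(k,x) = 1 − G_I(k,0) − G_I(k,1) + G_I(k,x) − G_II(k,1−x)`. -/
noncomputable def vgf (p : Measure GameS) (k : ℝ≥0) (x : ℝ) : ℝ :=
  1 - Gk p true k 0 - Gk p true k 1 + Gk p true k x - Gk p false k (1 - x)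


/-- A function on `[a,b]` whose second derivative is monotone on `(a,b)` is first concave,
then convex. -/
theorem exists_concaveOn_convexOn_of_monotoneOn_deriv2 {a b : ℝ} (hab : a ≤ b) {f f' f'' : ℝ → ℝ}
    (hf : ContinuousOn f (Icc a b)) (hf' : ∀ x ∈ Ioo a b, HasDerivAt f (f' x) x)
    (hf'' : ∀ x ∈ Ioo a b, HasDerivAt f' (f'' x) x) (hmono : MonotoneOn f'' (Ioo a b)) :
    ∃ c ∈ Icc a b, ConcaveOn ℝ (Icc a c) f ∧ ConvexOn ℝ (Icc c b) f := by
  set T : Set ℝ := insert a {x ∈ Ioo a b | f'' x ≤ 0} with hT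
  have hTb : ∀ x ∈ T, x ≤ b := by
    rintro x (rfl | hx)
    exacts [hab, hx.1.2.le]
  have hbdd : BddAbove T := ⟨b, hTb⟩
  have hne : T.Nonempty := ⟨a, mem_insert _ _⟩
  have hac : a ≤ sSup T := le_csSup hbdd (mem_insert _ _)
  have hcb : sSup T ≤ b := csSup_le hne hTb
  refine ⟨sSup T, ⟨hac, hcb⟩, ?_, ?_⟩
  · refine concaveOn_of_hasDerivWithinAt2_nonpos (f' := f') (f'' := f'') (convex_Icc _ _)
      (hf.mono (Icc_subset_Icc_right hcb)) ?_ ?_ ?_ <;> rw [interior_Icc] <;> intro x hx <;>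
      have hx' : x ∈ Ioo a b := ⟨hx.1, hx.2.trans_le hcb⟩
    · exact (hf' x hx').hasDerivWithinAt
    · exact (hf'' x hx').hasDerivWithinAt
    · obtain ⟨y, rfl | hy, hxy⟩ := exists_lt_of_lt_csSup hne hx.2
      · exact absurd hxy hx.1.not_gt
      · exact (hmono hx' hy.1 hxy.le).trans hy.2
  · refine convexOn_of_hasDerivWithinAt2_nonneg (f' := f') (f'' := f'') (convex_Icc _ _)
      (hf.mono (Icc_subset_Icc_left hac)) ?_ ?_ ?_ <;> rw [interior_Icc] <;> intro x hx <;>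
      have hx' : x ∈ Ioo a b := ⟨hac.trans_lt hx.1, hx.2⟩
    · exact (hf' x hx').hasDerivWithinAt
    · exact (hf'' x hx').hasDerivWithinAt
    · by_contra! h
      exact hx.1.not_ge (le_csSup hbdd (mem_insert_of_mem _ ⟨hx', h.le⟩))

theorem succ_mul_pow_mul_sub_le {r s : ℝ} (hr : 0 ≤ r) (hrs : r ≤ s) (n : ℕ) :
    (n + 1) * r ^ n * (s - r) ≤ s ^ (n + 1) - r ^ (n + 1) := by
  induction n with
  | zero => simp
  | succ n ih =>
    have h1 := mul_le_mul_of_nonneg_left ih hr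
    have h2 := mul_nonneg (sub_nonneg.2 hrs) (sub_nonneg.2 (pow_le_pow_left₀ hr hrs (n + 1)))
    push_cast
    ring_nf at h1 h2 ⊢
    linarith

/-- Summability inside the unit disc is inherited by the coefficients of the derived series. -/
theorem summable_abs_derived_mul_pow {b : ℕ → ℝ}
    (hb : ∀ r : ℝ, 0 ≤ r → r < 1 → Summable fun n ↦ |b n| * r ^ n) {r : ℝ} (hr : 0 ≤ r)
    (hr1 : r < 1) : Summable fun n : ℕ ↦ |(n + 1) * b (n + 1)| * r ^ n := by
  obtain ⟨s, hrs, hs1⟩ := exists_between hr1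
  have hs := ((summable_nat_add_iff 1).2 (hb s (hr.trans hrs.le) hs1)).div_const (s - r)
  refine hs.of_nonneg_of_le (fun n ↦ by positivity) fun n ↦ ?_
  rw [le_div_iff₀ (sub_pos.2 hrs), abs_mul, abs_of_nonneg (by positivity : (0 : ℝ) ≤ n + 1)]
  have h := succ_mul_pow_mul_sub_le hr hrs.le n
  have h' : (n + 1) * r ^ n * (s - r) ≤ s ^ (n + 1) := by linarith [pow_nonneg hr (n + 1)]
  calc (n + 1) * |b (n + 1)| * r ^ n * (s - r)
      = |b (n + 1)| * ((n + 1) * r ^ n * (s - r)) := by ring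
    _ ≤ |b (n + 1)| * s ^ (n + 1) := by gcongr

/-- Termwise differentiation of a real power series inside the unit disc. -/
theorem hasDerivAt_tsum_mul_pow {b : ℕ → ℝ}
    (hb : ∀ r : ℝ, 0 ≤ r → r < 1 → Summable fun n ↦ |b n| * r ^ n) {x : ℝ} (hx : |x| < 1) :
    HasDerivAt (fun y ↦ ∑' n, b n * y ^ n) (∑' n : ℕ, (n + 1) * b (n + 1) * x ^ n) x := by
  obtain ⟨r, hxr, hr1⟩ := exists_between hx
  have hr : 0 < r := (abs_nonneg x).trans_lt hxr
  have hu : Summable fun n : ℕ ↦ |b n| * (n * r ^ (n - 1)) := by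
    rw [← summable_nat_add_iff 1]
    refine (summable_abs_derived_mul_pow hb hr.le hr1).congr fun n ↦ ?_
    rw [abs_mul, abs_of_nonneg (by positivity : (0 : ℝ) ≤ n + 1)]
    push_cast
    ring
  have hbound : ∀ (n : ℕ) (y : ℝ), y ∈ Ioo (-r) r →
      ‖b n * (n * y ^ (n - 1))‖ ≤ |b n| * (n * r ^ (n - 1)) := by
    intro n y hy
    rw [Real.norm_eq_abs, abs_mul, abs_mul, abs_pow, Nat.abs_cast]
    have := (abs_lt.2 hy).le
    gcongr
  have hmem : x ∈ Ioo (-r) r := abs_lt.1 hxr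
  have key := hasDerivAt_tsum_of_isPreconnected hu isOpen_Ioo isPreconnected_Ioo
    (g := fun n y ↦ b n * y ^ n) (fun n y _ ↦ (hasDerivAt_pow n y).const_mul (b n)) hbound
    (show (0 : ℝ) ∈ Ioo (-r) r from ⟨neg_lt_zero.2 hr, hr⟩)
    (summable_of_ne_finset_zero (s := {0}) fun n hn ↦ by
      simp [show n ≠ 0 by simpa using hn]) hmem
  refine key.congr_deriv ?_
  rw [(Summable.of_norm_bounded hu fun n ↦ hbound n x hmem).tsum_eq_zero_add]
  simp only [Nat.cast_zero, zero_mul, mul_zero, zero_add, Nat.add_sub_cancel]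
  refine tsum_congr fun n ↦ ?_
  push_cast
  ring

theorem monotoneOn_tsum_mul_pow {b : ℕ → ℝ} (hb0 : ∀ n, 0 ≤ b n)
    (hb : ∀ r : ℝ, 0 ≤ r → r < 1 → Summable fun n ↦ |b n| * r ^ n) :
    MonotoneOn (fun x ↦ ∑' n, b n * x ^ n) (Ioo 0 1) := by
  intro x hx y hy hxy
  have hs : ∀ z ∈ Ioo (0 : ℝ) 1, Summable fun n ↦ b n * z ^ n := fun z hz ↦
    (hb z hz.1.le hz.2).congr fun n ↦ by rw [abs_of_nonneg (hb0 n)]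
  exact (hs x hx).tsum_le_tsum
    (fun n ↦ mul_le_mul_of_nonneg_left (pow_le_pow_left₀ hx.1.le hxy n) (hb0 n)) (hs y hy)

theorem continuousOn_tsum_mul_pow {b : ℕ → ℝ} (hb : Summable fun n ↦ |b n|) :
    ContinuousOn (fun x ↦ ∑' n, b n * x ^ n) (Icc 0 1) := by
  refine continuousOn_tsum (fun n ↦ by fun_prop) hb fun n x hx ↦ ?_
  rw [Real.norm_eq_abs, abs_mul, abs_pow, abs_of_nonneg hx.1]
  exact mul_le_of_le_one_right (abs_nonneg _) (pow_le_one₀ hx.1 hx.2)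

/-- A power series on `[0,1]` with nonnegative summable coefficients is continuous, and on the
interior it has two derivatives, the second one being monotone. -/
theorem exists_deriv2_tsum_mul_pow {b : ℕ → ℝ} (hb0 : ∀ n, 0 ≤ b n) (hb : Summable b) :
    ∃ g' g'' : ℝ → ℝ, (∀ x ∈ Ioo (0 : ℝ) 1, HasDerivAt (fun y ↦ ∑' n, b n * y ^ n) (g' x) x) ∧
      (∀ x ∈ Ioo (0 : ℝ) 1, HasDerivAt g' (g'' x) x) ∧ MonotoneOn g'' (Ioo 0 1) := by
  have h0 : ∀ r : ℝ, 0 ≤ r → r < 1 → Summable fun n ↦ |b n| * r ^ n := fun r hr hr1 ↦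
    hb.abs.of_nonneg_of_le (fun n ↦ by positivity) fun n ↦
      mul_le_of_le_one_right (abs_nonneg _) (pow_le_one₀ hr hr1.le)
  have h1 := fun (r : ℝ) (hr : 0 ≤ r) (hr1 : r < 1) ↦ summable_abs_derived_mul_pow h0 hr hr1
  have h2 := fun (r : ℝ) (hr : 0 ≤ r) (hr1 : r < 1) ↦
    summable_abs_derived_mul_pow (b := fun n ↦ (n + 1) * b (n + 1)) h1 hr hr1
  have habs : ∀ x ∈ Ioo (0 : ℝ) 1, |x| < 1 := fun x hx ↦ abs_lt.2 ⟨by linarith [hx.1], hx.2⟩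
  refine ⟨_, _, fun x hx ↦ hasDerivAt_tsum_mul_pow h0 (habs x hx), fun x hx ↦
    hasDerivAt_tsum_mul_pow (b := fun n ↦ (n + 1) * b (n + 1)) h1 (habs x hx),
    monotoneOn_tsum_mul_pow (fun n ↦ ?_) h2⟩
  have := hb0 (n + 1 + 1)
  positivity

theorem summable_pk (p : Measure GameS) [IsFiniteMeasure p] (i : Bool) (k : ℝ≥0) :
    Summable (pk p i k) := by
  refine ENNReal.summable_toReal ?_
  rw [← measure_iUnion]
  · exact measure_ne_top _ _
  · intro m n hmn
    exact Set.disjoint_left.2 fun s hm hn ↦ hmn (hm.2.2.symm.trans hn.2.2)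
  · intro n
    exact (measurableSet_eq_fun (by fun_prop) (by fun_prop)).inter
      ((measurableSet_le (by fun_prop) (by fun_prop)).inter
        (measurableSet_eq_fun (by fun_prop) (by fun_prop)))

/-- for `k ≥ 0`, there is `c ∈ [0,1]` such that `f_k` is concave on `[0,c]`
and convex on `[c,1]`. -/
theorem vgf_concave_convex_split
    (p : Measure GameS) [IsProbabilityMeasure p] (k : ℝ≥0) :
    ∃ c ∈ Set.Icc (0:ℝ) 1,
      ConcaveOn ℝ (Set.Icc 0 c) (vgf p k) ∧ ConvexOn ℝ (Set.Icc c 1) (vgf p k) := by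
  have hcont (i : Bool) : ContinuousOn (Gk p i k) (Icc 0 1) :=
    continuousOn_tsum_mul_pow (summable_pk p i k).abs
  obtain ⟨g', g'', hg, hg', hg''⟩ := exists_deriv2_tsum_mul_pow (b := pk p true k)
    (fun _ ↦ ENNReal.toReal_nonneg) (summable_pk p true k)
  obtain ⟨h', h'', hh, hh', hh''⟩ := exists_deriv2_tsum_mul_pow (b := pk p false k)
    (fun _ ↦ ENNReal.toReal_nonneg) (summable_pk p false k)
  have hrefl : ∀ x ∈ Ioo (0 : ℝ) 1, 1 - x ∈ Ioo (0 : ℝ) 1 := fun x hx ↦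
    ⟨sub_pos.2 hx.2, sub_lt_self 1 hx.1⟩
  refine exists_concaveOn_convexOn_of_monotoneOn_deriv2 zero_le_one
    (f' := fun x ↦ g' x + h' (1 - x)) (f'' := fun x ↦ g'' x - h'' (1 - x)) ?_ ?_ ?_ ?_
  · refine (continuousOn_const.add (hcont true)).sub
      ((hcont false).comp (by fun_prop) fun x hx ↦ ?_)
    exact ⟨sub_nonneg.2 hx.2, sub_le_self 1 hx.1⟩
  · intro x hx
    have h := ((hg x hx).const_add (1 - Gk p true k 0 - Gk p true k 1)).sub
      ((hh (1 - x) (hrefl x hx)).comp_const_sub 1 x)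
    rw [sub_neg_eq_add] at h
    exact h
  · intro x hx
    exact (hg' x hx).add ((hh' (1 - x) (hrefl x hx)).comp_const_sub 1 x)
  · intro x hx y hy hxy
    exact sub_le_sub (hg'' hx hy hxy)
      (hh'' (hrefl y hy) (hrefl x hx) (sub_le_sub_left hxy 1))
end

section
/- Let k ≥ 0 and suppose that f_k is not the identity map on [0,1]. If s ∈ (0,1) is a fixed point of f_k, then x < f_k(x) for every x ∈ (0,s) and f_k(x) < x for every x ∈ (s,1). In particular, f_k has at most one fixed point in the open interval (0,1). -/
open MeasureTheory Set Filter Topology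
open scoped ENNReal NNReal

lemma measurableSet_gameS_slice (i : Bool) (k : ℝ≥0) (n : ℕ) :
    MeasurableSet {s : GameS | s.1 = i ∧ k ≤ s.2.1 ∧ s.2.2 = n} :=
  (measurableSet_eq_fun measurable_fst measurable_const).inter
    ((measurableSet_le measurable_const measurable_snd.fst).inter
      (measurableSet_eq_fun measurable_snd.snd measurable_const))

lemma pk_nonneg (p : Measure GameS) (i : Bool) (k : ℝ≥0) (n : ℕ) : 0 ≤ pk p i k n :=
  ENNReal.toReal_nonneg

lemma hasSum_pk (p : Measure GameS) [IsProbabilityMeasure p] (i : Bool) (k : ℝ≥0) :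
    HasSum (pk p i k) (p {s : GameS | s.1 = i ∧ k ≤ s.2.1}).toReal := by
  have hU : {s : GameS | s.1 = i ∧ k ≤ s.2.1} =
      ⋃ n : ℕ, {s : GameS | s.1 = i ∧ k ≤ s.2.1 ∧ s.2.2 = n} := by
    ext s; simp
  have hd : Pairwise (Function.onFun Disjoint
      fun n : ℕ => {s : GameS | s.1 = i ∧ k ≤ s.2.1 ∧ s.2.2 = n}) := by
    intro m n hmn
    refine Set.disjoint_left.2 fun s hm hn => hmn ?_
    exact hm.2.2.symm.trans hn.2.2
  have h := measure_iUnion (μ := p) hd fun n => measurableSet_gameS_slice i k n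
  have hne := h ▸ measure_ne_top p _
  rw [hU, h, ENNReal.tsum_toReal_eq fun n => ENNReal.ne_top_of_tsum_ne_top hne n]
  exact ENNReal.hasSum_toReal hne

lemma hasSum_Gk (p : Measure GameS) [IsProbabilityMeasure p] (i : Bool) (k : ℝ≥0) {x : ℝ}
    (hx : x ∈ Set.Icc (0 : ℝ) 1) : HasSum (fun n => pk p i k n * x ^ n) (Gk p i k x) := by
  refine (Summable.of_nonneg_of_le (fun n => ?_) (fun n => ?_) (hasSum_pk p i k).summable).hasSum
  · exact mul_nonneg (pk_nonneg ..) (pow_nonneg hx.1 n)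
  · exact mul_le_of_le_one_right (pk_nonneg ..) (pow_le_one₀ hx.1 hx.2)

lemma Gk_zero (p : Measure GameS) (i : Bool) (k : ℝ≥0) : Gk p i k 0 = pk p i k 0 := by
  rw [Gk, tsum_eq_single 0]
  · simp
  · intro n hn; simp [hn]

lemma Gk_one_add_Gk_one_le (p : Measure GameS) [IsProbabilityMeasure p] (k : ℝ≥0) :
    Gk p true k 1 + Gk p false k 1 ≤ 1 := by
  have h (i : Bool) : Gk p i k 1 = p.real {s : GameS | s.1 = i ∧ k ≤ s.2.1} := by
    simpa [Gk, Measure.real] using (hasSum_pk p i k).tsum_eq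
  have hm : MeasurableSet {s : GameS | s.1 = false ∧ k ≤ s.2.1} :=
    (measurableSet_eq_fun measurable_fst measurable_const).inter
      (measurableSet_le (f := fun _ : GameS => k) measurable_const measurable_snd.fst)
  rw [h, h, ← measureReal_union _ hm]
  · exact measureReal_le_one
  · refine Set.disjoint_left.2 fun s hs ht => ?_
    simp [hs.1] at ht

lemma vgf_zero_nonneg (p : Measure GameS) [IsProbabilityMeasure p] (k : ℝ≥0) :
    0 ≤ vgf p k 0 := by
  have := Gk_one_add_Gk_one_le p k
  rw [vgf, sub_zero]
  linarith

lemma vgf_one_le_one (p : Measure GameS) (k : ℝ≥0) : vgf p k 1 ≤ 1 := by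
  have h1 := pk_nonneg p true k 0
  have h2 := pk_nonneg p false k 0
  rw [vgf, sub_self, Gk_zero, Gk_zero]
  linarith

/-- The third divided difference of `h` at `0, u, v, 1`, multiplied by
`u * v * (v - u) * (1 - u) * (1 - v)`. -/
def scaledDivDiff (h : ℝ → ℝ) (u v : ℝ) : ℝ :=
  -(h 0 * ((v - u) * (1 - u) * (1 - v))) + h u * (v * (1 - v)) - h v * (u * (1 - u))
    + h 1 * (u * v * (v - u))

lemma scaledDivDiff_pow_succ (m : ℕ) (u v : ℝ) :
    scaledDivDiff (· ^ (m + 1)) u v = u * v * ((1 - u) * (1 - v)) *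
      ∑ i ∈ Finset.range m, (v ^ i - u ^ i) := by
  have hu := mul_neg_geom_sum u m
  have hv := mul_neg_geom_sum v m
  rw [Finset.sum_sub_distrib]
  simp only [scaledDivDiff, one_pow, pow_succ, mul_zero, zero_mul]
  linear_combination (u * v * (1 - v)) * hu - (u * v * (1 - u)) * hv

lemma scaledDivDiff_pow_of_lt_three {n : ℕ} (hn : n < 3) (u v : ℝ) :
    scaledDivDiff (· ^ n) u v = 0 := by
  interval_cases n <;> simp only [scaledDivDiff] <;> ring

lemma scaledDivDiff_pow_pos {n : ℕ} (hn : 3 ≤ n) {u v : ℝ} (hu : 0 < u) (huv : u < v)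
    (hv : v < 1) : 0 < scaledDivDiff (· ^ n) u v := by
  obtain ⟨m, rfl⟩ : ∃ m, n = m + 1 := ⟨n - 1, by omega⟩
  rw [scaledDivDiff_pow_succ]
  have h1 : 0 < u * v * ((1 - u) * (1 - v)) :=
    mul_pos (mul_pos hu (hu.trans huv)) (mul_pos (by linarith) (by linarith))
  refine mul_pos h1 (Finset.sum_pos' (fun i _ => ?_) ⟨1, ?_, ?_⟩)
  · exact sub_nonneg.2 (pow_le_pow_left₀ hu.le huv.le i)
  · simp; omega
  · simpa using huv

lemma scaledDivDiff_pow_nonneg (n : ℕ) {u v : ℝ} (hu : 0 < u) (huv : u < v)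
    (hv : v < 1) : 0 ≤ scaledDivDiff (· ^ n) u v := by
  rcases lt_or_ge n 3 with hn | hn
  · exact (scaledDivDiff_pow_of_lt_three hn u v).ge
  · exact (scaledDivDiff_pow_pos hn hu huv hv).le

lemma hasSum_scaledDivDiff_Gk (p : Measure GameS) [IsProbabilityMeasure p] (i : Bool)
    (k : ℝ≥0) {u v : ℝ} (hu : 0 < u) (huv : u < v) (hv : v < 1) :
    HasSum (fun n => pk p i k n * scaledDivDiff (· ^ n) u v)
      (scaledDivDiff (Gk p i k) u v) := by
  have h0 := hasSum_Gk p i k (x := 0) (by simp)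
  have h1 := hasSum_Gk p i k (x := 1) (by simp)
  have h2 := hasSum_Gk p i k (x := u) ⟨hu.le, by linarith⟩
  have h3 := hasSum_Gk p i k (x := v) ⟨by linarith, hv.le⟩
  have h : HasSum _ (scaledDivDiff (Gk p i k) u v) :=
    ((((h0.mul_right ((v - u) * (1 - u) * (1 - v))).neg.add
      (h2.mul_right (v * (1 - v)))).sub (h3.mul_right (u * (1 - u)))).add
      (h1.mul_right (u * v * (v - u))))
  convert h using 2 with n
  simp only [scaledDivDiff]
  ring

lemma scaledDivDiff_Gk_nonneg (p : Measure GameS) [IsProbabilityMeasure p] (i : Bool)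
    (k : ℝ≥0) {u v : ℝ} (hu : 0 < u) (huv : u < v) (hv : v < 1) :
    0 ≤ scaledDivDiff (Gk p i k) u v :=
  (hasSum_scaledDivDiff_Gk p i k hu huv hv).nonneg fun n =>
    mul_nonneg (pk_nonneg ..) (scaledDivDiff_pow_nonneg n hu huv hv)

lemma scaledDivDiff_Gk_eq_zero (p : Measure GameS) [IsProbabilityMeasure p] (i : Bool)
    (k : ℝ≥0) {u v : ℝ} (hu : 0 < u) (huv : u < v) (hv : v < 1)
    (h : scaledDivDiff (Gk p i k) u v = 0) {u' v' : ℝ} (hu' : 0 < u') (huv' : u' < v')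
    (hv' : v' < 1) : scaledDivDiff (Gk p i k) u' v' = 0 := by
  have hs := hasSum_scaledDivDiff_Gk p i k hu huv hv
  rw [h, hasSum_zero_iff_of_nonneg fun n =>
    mul_nonneg (pk_nonneg ..) (scaledDivDiff_pow_nonneg n hu huv hv)] at hs
  refine (hasSum_scaledDivDiff_Gk p i k hu' huv' hv').unique ?_
  convert hasSum_zero with n
  rcases lt_or_ge n 3 with hn | hn
  · rw [scaledDivDiff_pow_of_lt_three hn, mul_zero]
  · rw [(mul_eq_zero.1 (congrFun hs n)).resolve_right
      (scaledDivDiff_pow_pos hn hu huv hv).ne', zero_mul]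

lemma scaledDivDiff_vgf (p : Measure GameS) (k : ℝ≥0) (u v : ℝ) :
    scaledDivDiff (vgf p k) u v =
      scaledDivDiff (Gk p true k) u v + scaledDivDiff (Gk p false k) (1 - v) (1 - u) := by
  simp only [scaledDivDiff, vgf, sub_zero, sub_self]
  ring

lemma scaledDivDiff_vgf_nonneg (p : Measure GameS) [IsProbabilityMeasure p] (k : ℝ≥0)
    {u v : ℝ} (hu : 0 < u) (huv : u < v) (hv : v < 1) : 0 ≤ scaledDivDiff (vgf p k) u v := by
  rw [scaledDivDiff_vgf]
  exact add_nonneg (scaledDivDiff_Gk_nonneg p true k hu huv hv)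
    (scaledDivDiff_Gk_nonneg p false k (by linarith) (by linarith) (by linarith))

lemma scaledDivDiff_vgf_eq_zero (p : Measure GameS) [IsProbabilityMeasure p] (k : ℝ≥0)
    {u v : ℝ} (hu : 0 < u) (huv : u < v) (hv : v < 1) (h : scaledDivDiff (vgf p k) u v = 0)
    {u' v' : ℝ} (hu' : 0 < u') (huv' : u' < v') (hv' : v' < 1) :
    scaledDivDiff (vgf p k) u' v' = 0 := by
  have h1 := scaledDivDiff_Gk_nonneg p true k hu huv hv
  have h2 := scaledDivDiff_Gk_nonneg p false k (u := 1 - v) (v := 1 - u)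
    (by linarith) (by linarith) (by linarith)
  rw [scaledDivDiff_vgf] at h ⊢
  rw [scaledDivDiff_Gk_eq_zero p true k hu huv hv (by linarith) hu' huv' hv',
    scaledDivDiff_Gk_eq_zero p false k (u := 1 - v) (v := 1 - u) (by linarith) (by linarith)
      (by linarith) (by linarith) (by linarith) (by linarith) (by linarith), add_zero]

/-- The scaled divided difference is unchanged by subtracting the identity. -/
lemma scaledDivDiff_eq_sub_id (h : ℝ → ℝ) (u v : ℝ) :
    scaledDivDiff h u v = -(h 0 * ((v - u) * (1 - u) * (1 - v)))
      + (h u - u) * (v * (1 - v)) - (h v - v) * (u * (1 - u))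
      + (h 1 - 1) * (u * v * (v - u)) := by
  simp only [scaledDivDiff]
  ring

lemma vgf_eq_id_of_scaledDivDiff_eq_zero (p : Measure GameS) [IsProbabilityMeasure p] (k : ℝ≥0)
    {s : ℝ} (hs : s ∈ Set.Ioo (0 : ℝ) 1) (hfix : vgf p k s = s) (h0 : vgf p k 0 = 0)
    (h1 : vgf p k 1 = 1)
    (h : ∀ u v : ℝ, 0 < u → u < v → v < 1 → scaledDivDiff (vgf p k) u v = 0)
    {x : ℝ} (hx : x ∈ Set.Icc (0 : ℝ) 1) : vgf p k x = x := by
  obtain ⟨hs0, hs1⟩ := hs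
  rcases hx.1.eq_or_lt with rfl | hx0
  · exact h0
  rcases hx.2.eq_or_lt with rfl | hx1
  · exact h1
  rcases lt_trichotomy x s with hlt | rfl | hlt
  · have := h x s hx0 hlt hs1
    rw [scaledDivDiff_eq_sub_id, h0, h1, hfix] at this
    have hm : (vgf p k x - x) * (s * (1 - s)) = 0 := by linarith
    have hne : s * (1 - s) ≠ 0 := (mul_pos hs0 (by linarith)).ne'
    exact sub_eq_zero.1 ((mul_eq_zero.1 hm).resolve_right hne)
  · exact hfix
  · have := h s x hs0 hlt hx1
    rw [scaledDivDiff_eq_sub_id, h0, h1, hfix] at this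
    have hm : (vgf p k x - x) * (s * (1 - s)) = 0 := by linarith
    have hne : s * (1 - s) ≠ 0 := (mul_pos hs0 (by linarith)).ne'
    exact sub_eq_zero.1 ((mul_eq_zero.1 hm).resolve_right hne)

/-- If the contribution of the interior nodes `u, v` to the divided difference of `f_k - id` is
nonpositive, then `f_k` is the identity. -/
lemma vgf_eq_id_of_scaledDivDiff_nonpos (p : Measure GameS) [IsProbabilityMeasure p] (k : ℝ≥0)
    {s : ℝ} (hs : s ∈ Set.Ioo (0 : ℝ) 1) (hfix : vgf p k s = s)
    {u v : ℝ} (hu : 0 < u) (huv : u < v) (hv : v < 1)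
    (h : (vgf p k u - u) * (v * (1 - v)) - (vgf p k v - v) * (u * (1 - u)) ≤ 0) :
    ∀ x ∈ Set.Icc (0 : ℝ) 1, vgf p k x = x := by
  have hD := scaledDivDiff_vgf_nonneg p k hu huv hv
  have hc0 : 0 < (v - u) * (1 - u) * (1 - v) :=
    mul_pos (mul_pos (by linarith) (by linarith)) (by linarith)
  have hc1 : 0 < u * v * (v - u) := mul_pos (mul_pos hu (hu.trans huv)) (by linarith)
  have ha : 0 ≤ vgf p k 0 * ((v - u) * (1 - u) * (1 - v)) :=
    mul_nonneg (vgf_zero_nonneg p k) hc0.le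
  have hb : (vgf p k 1 - 1) * (u * v * (v - u)) ≤ 0 :=
    mul_nonpos_of_nonpos_of_nonneg (sub_nonpos.2 (vgf_one_le_one p k)) hc1.le
  have hE := scaledDivDiff_eq_sub_id (vgf p k) u v
  have h0 : vgf p k 0 = 0 :=
    (mul_eq_zero.1 (show vgf p k 0 * ((v - u) * (1 - u) * (1 - v)) = 0 by
      linarith)).resolve_right hc0.ne'
  have h1 : vgf p k 1 = 1 := sub_eq_zero.1
    ((mul_eq_zero.1 (show (vgf p k 1 - 1) * (u * v * (v - u)) = 0 by
      linarith)).resolve_right hc1.ne')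
  intro x hx
  exact vgf_eq_id_of_scaledDivDiff_eq_zero p k hs hfix h0 h1
    (fun u' v' => scaledDivDiff_vgf_eq_zero p k hu huv hv (by linarith)) hx

/-- for `k ≥ 0`, if `f_k` is not the identity map on `[0,1]` and
`s ∈ (0,1)` is a fixed point of `f_k`, then `x < f_k(x)` on `(0,s)`, `f_k(x) < x` on
`(s,1)`, and `s` is the unique fixed point of `f_k` in `(0,1)`. -/
theorem vgf_fixed_point_unique
    (p : Measure GameS) [IsProbabilityMeasure p] (k : ℝ≥0)
    (hid : ¬ ∀ x ∈ Set.Icc (0:ℝ) 1, vgf p k x = x)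
    (s : ℝ) (hs : s ∈ Set.Ioo (0:ℝ) 1) (hfix : vgf p k s = s) :
    (∀ x ∈ Set.Ioo (0:ℝ) s, x < vgf p k x) ∧
    (∀ x ∈ Set.Ioo s (1:ℝ), vgf p k x < x) ∧
    (∀ s' ∈ Set.Ioo (0:ℝ) 1, vgf p k s' = s' → s' = s) := by
  have hc : 0 ≤ s * (1 - s) := mul_nonneg hs.1.le (by linarith [hs.2])
  have hlt : ∀ x ∈ Set.Ioo (0:ℝ) s, x < vgf p k x := by
    intro x hx
    by_contra! hle
    refine hid (vgf_eq_id_of_scaledDivDiff_nonpos p k hs hfix hx.1 hx.2 hs.2 ?_)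
    have := mul_nonpos_of_nonpos_of_nonneg (sub_nonpos.2 hle) hc
    rw [hfix]
    linarith
  have hgt : ∀ x ∈ Set.Ioo s (1:ℝ), vgf p k x < x := by
    intro x hx
    by_contra! hle
    refine hid (vgf_eq_id_of_scaledDivDiff_nonpos p k hs hfix hs.1 hx.1 hx.2 ?_)
    have := mul_nonneg (sub_nonneg.2 hle) hc
    rw [hfix]
    linarith
  refine ⟨hlt, hgt, fun s' hs' hfix' => ?_⟩
  rcases lt_trichotomy s' s with h | h | h
  · exact absurd hfix' (hlt s' ⟨hs'.1, h⟩).ne'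
  · exact h
  · exact absurd hfix' (hgt s' ⟨h, hs'.2⟩).ne
end

section
/- Fix k > 0. The map p ↦ α_p(k), from the space of Borel probability measures on S endowed with the topology of weak convergence to [0,1], is lower semicontinuous. -/
open MeasureTheory Set Filter Topology
open scoped ENNReal NNReal

/-- `α_p(k)`: the smallest fixed point of `f_k` in `[0,1]`. -/
noncomputable def alphaP (p : Measure GameS) (k : ℝ≥0) : ℝ :=
  sInf {x ∈ Set.Icc (0:ℝ) 1 | vgf p k x = x}

/-- For a closed set `F` and a nonnegative bounded continuous function `g`, the map
`p ↦ ∫ x in F, g x ∂p` is upper semicontinuous for weak convergence. -/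
theorem upperSemicontinuous_setIntegral_of_isClosed {X : Type*} [TopologicalSpace X]
    [MeasurableSpace X] [OpensMeasurableSpace X] [HasOuterApproxClosed X] {F : Set X}
    (hF : IsClosed F) (g : BoundedContinuousFunction X ℝ) (hg : ∀ x, 0 ≤ g x) :
    UpperSemicontinuous (fun p : ProbabilityMeasure X => ∫ x in F, g x ∂(p : Measure X)) := by
  intro p y hy
  let v : ℕ → BoundedContinuousFunction X ℝ := fun m =>
    BoundedContinuousFunction.ofNormedAddCommGroup (fun x => (hF.apprSeq m x : ℝ) * g x)
      (by fun_prop) ‖g‖ (by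
        intro x
        rw [norm_mul]
        have h1 : ‖(hF.apprSeq m x : ℝ)‖ ≤ 1 := by
          simpa using HasOuterApproxClosed.apprSeq_apply_le_one hF m x
        calc _ ≤ 1 * ‖g‖ := by gcongr; exact g.norm_coe_le_norm x
          _ = ‖g‖ := one_mul _)
  have hv : ∀ m x, v m x = (hF.apprSeq m x : ℝ) * g x := fun _ _ => rfl
  have hvnorm : ∀ m x, ‖v m x‖ ≤ ‖g‖ := fun m x =>
    (BoundedContinuousFunction.norm_coe_le_norm _ x).trans
      (BoundedContinuousFunction.norm_ofNormedAddCommGroup_le _ (norm_nonneg _) _)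
  have hlim : Tendsto (fun m => ∫ x, v m x ∂(p : Measure X)) atTop
      (𝓝 (∫ x in F, g x ∂(p : Measure X))) := by
    rw [← integral_indicator hF.measurableSet]
    refine tendsto_integral_of_dominated_convergence (fun _ => ‖g‖)
      (fun m => (v m).continuous.measurable.aestronglyMeasurable) (integrable_const _)
      (fun m => ae_of_all _ (hvnorm m)) (ae_of_all _ fun x => ?_)
    have h := tendsto_pi_nhds.1 (HasOuterApproxClosed.tendsto_apprSeq hF) x
    have hind : F.indicator g x = ((F.indicator (fun _ => (1 : ℝ≥0)) x : ℝ≥0) : ℝ) * g x := by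
      by_cases hx : x ∈ F <;> simp [hx]
    rw [hind]
    exact (NNReal.tendsto_coe.2 h).mul_const (g x)
  obtain ⟨m, hm⟩ := (hlim.eventually_lt_const hy).exists
  filter_upwards [((ProbabilityMeasure.continuous_integral_boundedContinuousFunction
    (v m)).tendsto p).eventually_lt_const hm] with q hq
  refine lt_of_le_of_lt ?_ hq
  rw [← integral_indicator hF.measurableSet]
  refine integral_mono ((g.integrable _).indicator hF.measurableSet) ((v m).integrable _)
    fun x => ?_
  by_cases hx : x ∈ F
  · simp [hx, hv, HasOuterApproxClosed.apprSeq_apply_eq_one hF m hx]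
  · simpa [hx, hv] using mul_nonneg (NNReal.coe_nonneg (hF.apprSeq m x)) (hg x)

/-- The least fixed point of a continuous monotone self-map of `[0,1]` depends lower
semicontinuously on a parameter in which the map is pointwise lower semicontinuous. -/
theorem lowerSemicontinuous_sInf_fixedPoints {P : Type*} [TopologicalSpace P] {f : P → ℝ → ℝ}
    (hcont : ∀ p, ContinuousOn (f p) (Icc 0 1)) (hmono : ∀ p, MonotoneOn (f p) (Icc 0 1))
    (hmaps : ∀ p, MapsTo (f p) (Icc 0 1) (Icc 0 1))
    (hlsc : ∀ x ∈ Icc (0 : ℝ) 1, LowerSemicontinuous fun p => f p x) :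
    LowerSemicontinuous fun p => sInf {x ∈ Icc (0 : ℝ) 1 | f p x = x} := by
  intro p y hy
  have hne : ∀ q, {x ∈ Icc (0 : ℝ) 1 | f q x = x}.Nonempty := fun q =>
    exists_mem_Icc_isFixedPt_of_mapsTo (hcont q) zero_le_one (hmaps q)
  have hbdd : ∀ q, BddBelow {x ∈ Icc (0 : ℝ) 1 | f q x = x} := fun q => ⟨0, fun x hx => hx.1.1⟩
  obtain ⟨z, hyz, hz⟩ := exists_between hy
  have hz1 : z ≤ 1 := by
    obtain ⟨x, hx⟩ := hne p
    exact hz.le.trans ((csInf_le (hbdd p) hx).trans hx.1.2)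
  have hlt : ∀ x ∈ Icc (0 : ℝ) z, x < f p x := by
    intro x hx
    by_contra! hle
    have hx1 : x ≤ 1 := hx.2.trans hz1
    obtain ⟨c, hc, hfix⟩ := exists_mem_Icc_isFixedPt
      ((hcont p).mono (Icc_subset_Icc_right hx1)) hx.1 (hmaps p ⟨le_rfl, zero_le_one⟩).1 hle
    have := csInf_le (hbdd p) (show c ∈ {x ∈ Icc (0 : ℝ) 1 | f p x = x} from
      ⟨⟨hc.1, hc.2.trans hx1⟩, hfix⟩)
    linarith [hc.2, hx.2]
  have hev : ∀ᶠ q in 𝓝 p, ∀ x ∈ Icc (0 : ℝ) z, x ∈ Icc (0 : ℝ) 1 → x < f q x := by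
    refine isCompact_Icc.eventually_forall_of_forall_eventually fun x hx => ?_
    have hxI : x ∈ Icc (0 : ℝ) 1 := ⟨hx.1, hx.2.trans hz1⟩
    obtain ⟨c, hxc, hc⟩ := exists_between (hlt x hx)
    obtain ⟨w, hwI, hwc, hw⟩ : ∃ w ∈ Icc (0 : ℝ) 1, c < f p w ∧
        ∀ᶠ x' in 𝓝 x, x' ∈ Icc (0 : ℝ) 1 → w ≤ x' := by
      rcases hx.1.eq_or_lt with h0 | h0
      · exact ⟨x, hxI, hc, Eventually.of_forall fun x' hx' => h0 ▸ hx'.1⟩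
      · have h1 : ∀ᶠ w in 𝓝[<] x, c < f p w ∧ w < x ∧ 0 < w := by
          have hle : 𝓝[<] x ≤ 𝓝[Icc 0 1] x := by
            refine nhdsWithin_le_of_mem ?_
            filter_upwards [self_mem_nhdsWithin, mem_nhdsWithin_of_mem_nhds (lt_mem_nhds h0)]
              with w hw hw0
            exact ⟨le_of_lt hw0, (le_of_lt hw).trans hxI.2⟩
          filter_upwards [hle ((hcont p x hxI).eventually_const_lt hc), self_mem_nhdsWithin,
            mem_nhdsWithin_of_mem_nhds (lt_mem_nhds h0)] with w h1 h2 h3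
          exact ⟨h1, h2, h3⟩
        obtain ⟨w, h1, h2, h3⟩ := h1.exists
        refine ⟨w, ⟨h3.le, h2.le.trans hxI.2⟩, h1, ?_⟩
        filter_upwards [lt_mem_nhds h2] with x' hx' _
        exact hx'.le
    rw [nhds_prod_eq]
    filter_upwards [(hlsc w hwI p c hwc).prod_mk (hw.and (gt_mem_nhds hxc))]
      with ⟨q, x'⟩ ⟨hq, hwx, hxc'⟩ hx'
    exact hxc'.trans (hq.trans_le (hmono q hwI hx' (hwx hx')))
  filter_upwards [hev] with q hq
  refine hyz.trans_le (le_csInf (hne q) fun x hx => ?_)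
  by_contra! hxz
  exact (hq x ⟨hx.1.1, hxz.le⟩ hx.1).ne' hx.2

/-- The probability weight lost by the value generating function at a vertex of capacity at
least `k`. -/
noncomputable def vgfDefect (x : ℝ) (s : GameS) : ℝ :=
  if s.1 then 0 ^ s.2.2 + 1 - x ^ s.2.2 else (1 - x) ^ s.2.2

theorem continuous_vgfDefect (x : ℝ) : Continuous (vgfDefect x) :=
  (continuous_of_discreteTopology (f := fun s : Bool × ℕ =>
    if s.1 then (0 : ℝ) ^ s.2 + 1 - x ^ s.2 else (1 - x) ^ s.2)).comp
    (continuous_fst.prodMk continuous_snd.snd)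

theorem vgfDefect_mem_Icc {x : ℝ} (hx : x ∈ Icc (0 : ℝ) 1) (s : GameS) :
    vgfDefect x s ∈ Icc (0 : ℝ) 1 := by
  obtain ⟨i, c, n⟩ := s
  have h0 := pow_nonneg hx.1 n
  have h1 := pow_le_one₀ hx.1 hx.2 (n := n)
  have h2 : 0 ≤ 1 - x := sub_nonneg.2 hx.2
  have h3 := pow_nonneg h2 n
  have h4 : (1 - x) ^ n ≤ 1 := pow_le_one₀ h2 (by linarith [hx.1])
  cases i
  · simpa [vgfDefect] using ⟨h3, h4⟩
  · rcases n with - | n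
    · simp [vgfDefect]
    · simpa [vgfDefect] using ⟨h1, h0⟩

theorem norm_vgfDefect_le_one {x : ℝ} (hx : x ∈ Icc (0 : ℝ) 1) (s : GameS) :
    ‖vgfDefect x s‖ ≤ 1 := by
  have h := vgfDefect_mem_Icc hx s
  rw [Real.norm_of_nonneg h.1]
  exact h.2

theorem continuous_vgfDefect_left (s : GameS) : Continuous fun x => vgfDefect x s := by
  unfold vgfDefect
  split_ifs <;> fun_prop

theorem antitoneOn_vgfDefect (s : GameS) : AntitoneOn (fun x => vgfDefect x s) (Icc 0 1) := by
  intro x hx y hy hxy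
  have h1 := pow_le_pow_left₀ hx.1 hxy s.2.2
  have h2 : (1 - y) ^ s.2.2 ≤ (1 - x) ^ s.2.2 :=
    pow_le_pow_left₀ (sub_nonneg.2 hy.2) (by linarith) _
  simp only [vgfDefect]
  split_ifs <;> linarith

/-- `vgfDefect x` as a bounded continuous function. -/
noncomputable def vgfDefectBCF (x : ℝ) (hx : x ∈ Icc (0 : ℝ) 1) :
    BoundedContinuousFunction GameS ℝ :=
  BoundedContinuousFunction.ofNormedAddCommGroup (vgfDefect x) (continuous_vgfDefect x) 1
    (norm_vgfDefect_le_one hx)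

theorem isClosed_capacity_ge (k : ℝ≥0) : IsClosed {s : GameS | k ≤ s.2.1} :=
  isClosed_le continuous_const (by fun_prop)

theorem measurableSet_player_capacity (i : Bool) (k : ℝ≥0) :
    MeasurableSet {s : GameS | s.1 = i ∧ k ≤ s.2.1} :=
  (measurableSet_eq_fun measurable_fst measurable_const).inter
    (isClosed_capacity_ge k).measurableSet

theorem integrable_pow_children (p : Measure GameS) [IsFiniteMeasure p] {x : ℝ}
    (hx : x ∈ Icc (0 : ℝ) 1) : Integrable (fun s : GameS => x ^ s.2.2) p := by
  refine .of_bound (Continuous.aestronglyMeasurable ?_) 1 (ae_of_all _ fun s => ?_)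
  · exact (continuous_of_discreteTopology (f := fun n : ℕ => x ^ n)).comp continuous_snd.snd
  · rw [Real.norm_of_nonneg (pow_nonneg hx.1 _)]
    exact pow_le_one₀ hx.1 hx.2

theorem Gk_eq_setIntegral (p : Measure GameS) [IsFiniteMeasure p] (i : Bool) (k : ℝ≥0) {x : ℝ}
    (hx : x ∈ Icc (0 : ℝ) 1) :
    Gk p i k x = ∫ s in {s : GameS | s.1 = i ∧ k ≤ s.2.1}, x ^ s.2.2 ∂p := by
  have hU : {s : GameS | s.1 = i ∧ k ≤ s.2.1} =
      ⋃ n : ℕ, {s : GameS | s.1 = i ∧ k ≤ s.2.1 ∧ s.2.2 = n} := by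
    ext s
    simp
  have hm : ∀ n : ℕ, MeasurableSet {s : GameS | s.1 = i ∧ k ≤ s.2.1 ∧ s.2.2 = n} := by
    intro n
    have := (measurableSet_player_capacity i k).inter
      (measurableSet_eq_fun (measurable_snd.snd : Measurable fun s : GameS => s.2.2)
        (measurable_const (a := n)))
    convert this using 1
    ext s
    simp [and_assoc]
  have hd : Pairwise (Function.onFun Disjoint
      fun n : ℕ => {s : GameS | s.1 = i ∧ k ≤ s.2.1 ∧ s.2.2 = n}) := by
    intro m n hmn
    refine Set.disjoint_left.2 fun s hs hs' => hmn ?_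
    exact hs.2.2.symm.trans hs'.2.2
  rw [hU, ← (hasSum_integral_iUnion hm hd (integrable_pow_children p hx).integrableOn).tsum_eq]
  refine tsum_congr fun n => ?_
  rw [setIntegral_congr_fun (g := fun _ => x ^ n) (hm n) (fun s hs => by simp [hs.2.2])]
  simp [pk, Measure.real]

theorem vgf_eq_one_sub_setIntegral (p : Measure GameS) [IsFiniteMeasure p] (k : ℝ≥0) {x : ℝ}
    (hx : x ∈ Icc (0 : ℝ) 1) :
    vgf p k x = 1 - ∫ s in {s : GameS | k ≤ s.2.1}, vgfDefect x s ∂p := by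
  have h0 : (0 : ℝ) ∈ Icc (0 : ℝ) 1 := ⟨le_rfl, zero_le_one⟩
  have h1 : (1 : ℝ) ∈ Icc (0 : ℝ) 1 := ⟨zero_le_one, le_rfl⟩
  have hx' : 1 - x ∈ Icc (0 : ℝ) 1 := ⟨sub_nonneg.2 hx.2, by linarith [hx.1]⟩
  have hint : Integrable (vgfDefect x) p :=
    (vgfDefectBCF x hx).integrable p
  have hU : {s : GameS | k ≤ s.2.1} =
      {s : GameS | s.1 = true ∧ k ≤ s.2.1} ∪ {s : GameS | s.1 = false ∧ k ≤ s.2.1} := by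
    ext ⟨i, s⟩
    cases i <;> simp
  have hd : Disjoint {s : GameS | s.1 = true ∧ k ≤ s.2.1}
      {s : GameS | s.1 = false ∧ k ≤ s.2.1} := by
    refine Set.disjoint_left.2 fun s hs hs' => ?_
    simpa [hs.1] using hs'.1
  rw [hU, setIntegral_union hd (measurableSet_player_capacity false k) hint.integrableOn
    hint.integrableOn]
  have hI : ∫ s in {s : GameS | s.1 = true ∧ k ≤ s.2.1}, vgfDefect x s ∂p =
      Gk p true k 0 + Gk p true k 1 - Gk p true k x := by
    have hsum : Integrable (fun s : GameS => (0 : ℝ) ^ s.2.2 + 1 ^ s.2.2) p :=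
      (integrable_pow_children p h0).add (integrable_pow_children p h1)
    rw [Gk_eq_setIntegral p _ _ h0, Gk_eq_setIntegral p _ _ h1, Gk_eq_setIntegral p _ _ hx,
      ← integral_add (integrable_pow_children p h0).integrableOn
        (integrable_pow_children p h1).integrableOn,
      ← integral_sub hsum.integrableOn (integrable_pow_children p hx).integrableOn]
    refine setIntegral_congr_fun (measurableSet_player_capacity true k) fun s hs => ?_
    simp [vgfDefect, hs.1]
  have hII : ∫ s in {s : GameS | s.1 = false ∧ k ≤ s.2.1}, vgfDefect x s ∂p =
      Gk p false k (1 - x) := by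
    rw [Gk_eq_setIntegral p _ _ hx']
    refine setIntegral_congr_fun (measurableSet_player_capacity false k) fun s hs => ?_
    simp [vgfDefect, hs.1]
  rw [hI, hII, vgf]
  ring

theorem continuousOn_vgf (p : Measure GameS) [IsFiniteMeasure p] (k : ℝ≥0) :
    ContinuousOn (vgf p k) (Icc 0 1) := by
  refine ContinuousOn.congr (continuousOn_const.sub ?_)
    fun x hx => vgf_eq_one_sub_setIntegral p k hx
  exact continuousOn_of_dominated (bound := fun _ => 1)
    (fun x _ => (continuous_vgfDefect x).aestronglyMeasurable)
    (fun x hx => ae_of_all _ (norm_vgfDefect_le_one hx)) (integrable_const _)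
    (ae_of_all _ fun s => (continuous_vgfDefect_left s).continuousOn)

theorem monotoneOn_vgf (p : Measure GameS) [IsFiniteMeasure p] (k : ℝ≥0) :
    MonotoneOn (vgf p k) (Icc 0 1) := by
  intro x hx y hy hxy
  rw [vgf_eq_one_sub_setIntegral p k hx, vgf_eq_one_sub_setIntegral p k hy]
  refine sub_le_sub_left (integral_mono ((vgfDefectBCF y hy).integrable _)
    ((vgfDefectBCF x hx).integrable _) fun s => antitoneOn_vgfDefect s hx hy hxy) _

theorem mapsTo_vgf (p : Measure GameS) [IsProbabilityMeasure p] (k : ℝ≥0) :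
    MapsTo (vgf p k) (Icc 0 1) (Icc 0 1) := by
  intro x hx
  rw [vgf_eq_one_sub_setIntegral p k hx]
  have h0 : 0 ≤ ∫ s in {s : GameS | k ≤ s.2.1}, vgfDefect x s ∂p :=
    integral_nonneg fun s => (vgfDefect_mem_Icc hx s).1
  have h1 : ∫ s in {s : GameS | k ≤ s.2.1}, vgfDefect x s ∂p ≤ 1 := by
    calc _ ≤ ∫ s, vgfDefect x s ∂p :=
          setIntegral_le_integral ((vgfDefectBCF x hx).integrable _)
            (ae_of_all _ fun s => (vgfDefect_mem_Icc hx s).1)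
      _ ≤ ∫ _, (1 : ℝ) ∂p := integral_mono ((vgfDefectBCF x hx).integrable _)
            (integrable_const _) fun s => (vgfDefect_mem_Icc hx s).2
      _ = 1 := by simp
  exact ⟨by linarith, by linarith⟩

theorem lowerSemicontinuous_vgf (k : ℝ≥0) {x : ℝ} (hx : x ∈ Icc (0 : ℝ) 1) :
    LowerSemicontinuous (fun p : ProbabilityMeasure GameS => vgf (p : Measure GameS) k x) := by
  intro p y hy
  change y < vgf (p : Measure GameS) k x at hy
  rw [vgf_eq_one_sub_setIntegral _ k hx] at hy
  filter_upwards [upperSemicontinuous_setIntegral_of_isClosed (isClosed_capacity_ge k)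
    (vgfDefectBCF x hx) (fun s => (vgfDefect_mem_Icc hx s).1) p (1 - y) (lt_sub_comm.1 hy)]
    with q hq
  change y < vgf (q : Measure GameS) k x
  rw [vgf_eq_one_sub_setIntegral _ k hx]
  exact lt_sub_comm.1 hq

/-- for fixed `k > 0`, the map `p ↦ α_p(k)` is lower semicontinuous on the
space of Borel probability measures on `S` with the topology of weak convergence. -/
theorem alphaP_lowerSemicontinuous (k : ℝ≥0) (hk : 0 < k) :
    LowerSemicontinuous (fun p : ProbabilityMeasure GameS => alphaP (p : Measure GameS) k) :=
  lowerSemicontinuous_sInf_fixedPoints (fun p => continuousOn_vgf (p : Measure GameS) k)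
    (fun p => monotoneOn_vgf (p : Measure GameS) k) (fun p => mapsTo_vgf (p : Measure GameS) k)
    fun _ hx => lowerSemicontinuous_vgf k hx
end

section
/- Let p and p̃ be activation-independent Borel probability measures on S having the same marginal μ on (γ,ξ), with Player I's activation probabilities q = p(ι = I) and q̃ = p̃(ι = I) satisfying q ≤ q̃. Then α_{p̃}(k) ≤ α_p(k) for every k > 0; that is, the smallest fixed point of the vgf is a non-increasing function of Player I's activation probability. -/
open MeasureTheory Set Filter Topology
open scoped ENNReal NNReal

/-- The activation-independent primitive distribution on `S` with Player I's activation
probability `q` and marginal `μ` on `(γ,ξ)`. -/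
noncomputable def actMeasure (q : ℝ≥0∞) (μ : Measure (ℝ≥0 × ℕ)) : Measure GameS :=
  (q • Measure.dirac true + (1 - q) • Measure.dirac false).prod μ

/-- The mass `μ({γ ≥ k} ∩ {ξ = n})`. -/
noncomputable def capacityMass (μ : Measure (ℝ≥0 × ℕ)) (k : ℝ≥0) (n : ℕ) : ℝ :=
  (μ {s | k ≤ s.1 ∧ s.2 = n}).toReal

/-- The generating function `G(k,x) = Σ_n μ({γ ≥ k} ∩ {ξ = n}) xⁿ`. -/
noncomputable def capacityGen (μ : Measure (ℝ≥0 × ℕ)) (k : ℝ≥0) (x : ℝ) : ℝ :=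
  ∑' n : ℕ, capacityMass μ k n * x ^ n

section CapacityGen

variable (μ : Measure (ℝ≥0 × ℕ)) (k : ℝ≥0)

lemma capacityMass_nonneg (n : ℕ) : 0 ≤ capacityMass μ k n := ENNReal.toReal_nonneg

lemma tsum_measure_capacity_le_one [IsProbabilityMeasure μ] :
    ∑' n : ℕ, μ {s | k ≤ s.1 ∧ s.2 = n} ≤ 1 := by
  refine (tsum_meas_le_meas_iUnion_of_disjoint μ (fun n => ?_) ?_).trans prob_le_one
  · exact (measurableSet_le measurable_const measurable_fst).inter
      (measurable_snd (measurableSet_singleton n))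
  · intro m n hmn
    refine Set.disjoint_left.2 fun s hm hn => hmn ?_
    exact hm.2.symm.trans hn.2

lemma summable_capacityMass [IsProbabilityMeasure μ] : Summable (capacityMass μ k) :=
  ENNReal.summable_toReal
    ((tsum_measure_capacity_le_one μ k).trans_lt ENNReal.one_lt_top).ne

lemma capacityGen_one_le_one [IsProbabilityMeasure μ] : capacityGen μ k 1 ≤ 1 := by
  have h := ENNReal.toReal_mono ENNReal.one_ne_top (tsum_measure_capacity_le_one μ k)
  rw [ENNReal.tsum_toReal_eq fun n => measure_ne_top μ _] at h
  simpa [capacityGen, capacityMass] using h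

lemma capacityGen_nonneg {x : ℝ} (hx : 0 ≤ x) : 0 ≤ capacityGen μ k x :=
  tsum_nonneg fun n => mul_nonneg (capacityMass_nonneg μ k n) (pow_nonneg hx n)

lemma capacityMass_mul_pow_le {x : ℝ} (hx : x ∈ Icc (0 : ℝ) 1) (n : ℕ) :
    capacityMass μ k n * x ^ n ≤ capacityMass μ k n :=
  mul_le_of_le_one_right (capacityMass_nonneg μ k n) (pow_le_one₀ hx.1 hx.2)

lemma summable_capacityMass_mul_pow [IsProbabilityMeasure μ] {x : ℝ} (hx : x ∈ Icc (0 : ℝ) 1) :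
    Summable fun n => capacityMass μ k n * x ^ n :=
  (summable_capacityMass μ k).of_nonneg_of_le
    (fun n => mul_nonneg (capacityMass_nonneg μ k n) (pow_nonneg hx.1 n))
    (capacityMass_mul_pow_le μ k hx)

lemma continuousOn_capacityGen [IsProbabilityMeasure μ] :
    ContinuousOn (capacityGen μ k) (Icc 0 1) := by
  refine continuousOn_tsum (fun n => by fun_prop) (summable_capacityMass μ k) fun n x hx => ?_
  rw [Real.norm_of_nonneg (mul_nonneg (capacityMass_nonneg μ k n) (pow_nonneg hx.1 n))]
  exact capacityMass_mul_pow_le μ k hx n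

lemma capacityGen_add_capacityGen_one_sub_le [IsProbabilityMeasure μ] {x : ℝ}
    (hx : x ∈ Icc (0 : ℝ) 1) :
    capacityGen μ k x + capacityGen μ k (1 - x) ≤ capacityGen μ k 0 + capacityGen μ k 1 := by
  have hx' : 1 - x ∈ Icc (0 : ℝ) 1 := ⟨by linarith [hx.2], by linarith [hx.1]⟩
  have s0 := summable_capacityMass_mul_pow μ k (left_mem_Icc.2 (zero_le_one' ℝ))
  have s1 := summable_capacityMass_mul_pow μ k (right_mem_Icc.2 (zero_le_one' ℝ))
  have sx := summable_capacityMass_mul_pow μ k hx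
  have sx' := summable_capacityMass_mul_pow μ k hx'
  unfold capacityGen
  rw [← sx.tsum_add sx', ← s0.tsum_add s1]
  refine (sx.add sx').tsum_le_tsum (fun n => ?_) (s0.add s1)
  rw [← mul_add, ← mul_add]
  refine mul_le_mul_of_nonneg_left ?_ (capacityMass_nonneg μ k n)
  rcases eq_or_ne n 0 with rfl | hn
  · simp
  · have h1 := pow_le_of_le_one hx.1 hx.2 hn
    have h2 := pow_le_of_le_one hx'.1 hx'.2 hn
    simp only [zero_pow hn, one_pow]
    linarith

end CapacityGen

section ActMeasure

variable (q : ℝ≥0∞) (μ : Measure (ℝ≥0 × ℕ)) [IsProbabilityMeasure μ] (k : ℝ≥0)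

lemma pk_actMeasure (i : Bool) (n : ℕ) :
    pk (actMeasure q μ) i k n = (if i then q else 1 - q).toReal * capacityMass μ k n := by
  have h : {s : GameS | s.1 = i ∧ k ≤ s.2.1 ∧ s.2.2 = n}
      = {i} ×ˢ {s : ℝ≥0 × ℕ | k ≤ s.1 ∧ s.2 = n} := by
    ext s
    simp
  rw [pk, h, actMeasure, Measure.prod_prod, ENNReal.toReal_mul, capacityMass]
  cases i <;> simp

lemma Gk_actMeasure (i : Bool) (x : ℝ) :
    Gk (actMeasure q μ) i k x = (if i then q else 1 - q).toReal * capacityGen μ k x := by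
  simp only [Gk, capacityGen, pk_actMeasure, mul_assoc, tsum_mul_left]

variable {q}

lemma vgf_actMeasure (hq : q ≤ 1) (x : ℝ) :
    vgf (actMeasure q μ) k x =
      1 - q.toReal * (capacityGen μ k 0 + capacityGen μ k 1 - capacityGen μ k x)
        - (1 - q.toReal) * capacityGen μ k (1 - x) := by
  have h : (1 - q).toReal = 1 - q.toReal := by
    rw [ENNReal.toReal_sub_of_le hq ENNReal.one_ne_top, ENNReal.toReal_one]
  simp only [vgf, Gk_actMeasure, if_true, Bool.false_eq_true, if_false, h]
  ring

lemma continuousOn_vgf_actMeasure (hq : q ≤ 1) :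
    ContinuousOn (vgf (actMeasure q μ) k) (Icc 0 1) := by
  have h := continuousOn_capacityGen μ k
  have h' : ContinuousOn (fun x => capacityGen μ k (1 - x)) (Icc 0 1) :=
    h.comp (by fun_prop) fun x hx => ⟨by linarith [hx.2], by linarith [hx.1]⟩
  refine ContinuousOn.congr ?_ fun x _ => vgf_actMeasure μ k hq x
  fun_prop

lemma vgf_actMeasure_zero_nonneg (hq : q ≤ 1) : 0 ≤ vgf (actMeasure q μ) k 0 := by
  rw [vgf_actMeasure μ k hq, sub_zero]
  linarith [capacityGen_one_le_one μ k]

lemma vgf_actMeasure_one_le_one (hq : q ≤ 1) : vgf (actMeasure q μ) k 1 ≤ 1 := by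
  rw [vgf_actMeasure μ k hq, sub_self]
  linarith [capacityGen_nonneg μ k le_rfl]

lemma vgf_actMeasure_anti {q' : ℝ≥0∞} (hqq' : q ≤ q') (hq' : q' ≤ 1) {x : ℝ}
    (hx : x ∈ Icc (0 : ℝ) 1) :
    vgf (actMeasure q' μ) k x ≤ vgf (actMeasure q μ) k x := by
  rw [vgf_actMeasure μ k hq', vgf_actMeasure μ k (hqq'.trans hq')]
  have h := ENNReal.toReal_mono (hq'.trans_lt ENNReal.one_lt_top).ne hqq'
  nlinarith [capacityGen_add_capacityGen_one_sub_le μ k hx]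

lemma exists_vgf_actMeasure_fixedPoint_le (hq : q ≤ 1) {x : ℝ} (hx : x ∈ Icc (0 : ℝ) 1)
    (hfx : vgf (actMeasure q μ) k x ≤ x) :
    ∃ y ∈ {y ∈ Icc (0 : ℝ) 1 | vgf (actMeasure q μ) k y = y}, y ≤ x := by
  obtain ⟨y, hy, hfy⟩ := exists_mem_Icc_isFixedPt
    ((continuousOn_vgf_actMeasure μ k hq).mono (Icc_subset_Icc_right hx.2)) hx.1
    (vgf_actMeasure_zero_nonneg μ k hq) hfx
  exact ⟨y, ⟨⟨hy.1, hy.2.trans hx.2⟩, hfy⟩, hy.2⟩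

end ActMeasure

/-- for activation-independent models sharing the marginal `μ` on `(γ,ξ)`,
with activation probabilities `q ≤ q̃`, one has `α_{p̃}(k) ≤ α_p(k)` for every `k > 0`:
the smallest fixed point of the vgf is non-increasing in Player I's activation
probability. -/
theorem alphaP_antitone_in_activation
    (μ : Measure (ℝ≥0 × ℕ)) [IsProbabilityMeasure μ]
    (q q' : ℝ≥0∞) (hqq' : q ≤ q') (hq' : q' ≤ 1) :
    ∀ k : ℝ≥0, 0 < k → alphaP (actMeasure q' μ) k ≤ alphaP (actMeasure q μ) k := by
  intro k _
  have hq := hqq'.trans hq'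
  obtain ⟨z, hz, -⟩ := exists_vgf_actMeasure_fixedPoint_le μ k hq
    (right_mem_Icc.2 zero_le_one) (vgf_actMeasure_one_le_one μ k hq)
  refine le_csInf ⟨z, hz⟩ fun x hx => ?_
  obtain ⟨y, hy, hyx⟩ := exists_vgf_actMeasure_fixedPoint_le μ k hq' hx.1
    ((vgf_actMeasure_anti μ k hqq' hq' hx.1).trans_eq hx.2)
  exact (csInf_le ⟨0, fun t ht => ht.1.1⟩ hy).trans hyx
end
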